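/- arXiv:1106.5891 — 5 statements merged into one kernel-verified Lean document; each statement's English description precedes it below -/
import Mathlib

section
/- Let A be an n×n real symmetric matrix, z ∈ ℂ \ ℝ, and G(z) = (zI − A)^{-1} (with A regarded as a complex matrix). Let F be a finite set of indices in {1,…,n} and (a_i)_{i∈F} positive real numbers. Then Im(z − Σ_{i∈F} a_i G(z)_{ii}) / Im(z) ≥ 1. -/
open Matrix in
lemma im_resolvent (n : ℕ) (A : Matrix (Fin n) (Fin n) ℝ) (hA : A.IsSymm) (z : ℂ) (i : Fin n) :
    ∃ c : ℝ, 0 ≤ c ∧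
      (((z • (1 : Matrix (Fin n) (Fin n) ℂ) - A.map Complex.ofReal)⁻¹) i i).im = - z.im * c := by
  set M : Matrix (Fin n) (Fin n) ℂ := z • (1 : Matrix (Fin n) (Fin n) ℂ) - A.map Complex.ofReal
    with hM
  by_cases hu : IsUnit M.det
  swap
  · refine ⟨0, le_rfl, ?_⟩
    rw [Matrix.nonsing_inv_apply_not_isUnit _ hu]
    simp
  have h1 : M * M⁻¹ = 1 := Matrix.mul_nonsing_inv _ hu
  have h2 : (M⁻¹)ᴴ * Mᴴ = 1 := by
    rw [← Matrix.conjTranspose_mul, h1, Matrix.conjTranspose_one]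
  have h3 : Mᴴ = M + (star z - z) • (1 : Matrix (Fin n) (Fin n) ℂ) := by
    have hA' : (A.map Complex.ofReal)ᴴ = A.map Complex.ofReal := by
      ext i j
      simp [Matrix.conjTranspose_apply, hA.apply i j]
    rw [hM, Matrix.conjTranspose_sub, hA', Matrix.conjTranspose_smul, Matrix.conjTranspose_one,
      sub_smul]
    abel
  have h4 : M⁻¹ = (M⁻¹)ᴴ + (star z - z) • ((M⁻¹)ᴴ * M⁻¹) := by
    calc M⁻¹ = ((M⁻¹)ᴴ * Mᴴ) * M⁻¹ := by rw [h2, Matrix.one_mul]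
      _ = (M⁻¹)ᴴ * (M * M⁻¹) + (star z - z) • ((M⁻¹)ᴴ * M⁻¹) := by
        rw [h3, Matrix.mul_add, Matrix.add_mul, Matrix.mul_assoc]
        simp
      _ = _ := by rw [h1, Matrix.mul_one]
  refine ⟨∑ j, Complex.normSq (M⁻¹ j i), Finset.sum_nonneg fun j _ => Complex.normSq_nonneg _, ?_⟩
  have h5 : ((M⁻¹)ᴴ * M⁻¹) i i = ((∑ j, Complex.normSq (M⁻¹ j i) : ℝ) : ℂ) := by
    rw [Matrix.mul_apply, Complex.ofReal_sum]
    refine Finset.sum_congr rfl fun j _ => ?_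
    rw [Complex.normSq_eq_conj_mul_self]
    rfl
  have h6 := congrArg Complex.im (congrFun (congrFun h4 i) i)
  rw [Matrix.add_apply, Matrix.smul_apply, h5, Matrix.conjTranspose_apply] at h6
  generalize (∑ j, Complex.normSq (M⁻¹ j i)) = c at *
  simp at h6
  linarith


/-- For an `n × n` real symmetric matrix `A`, non-real `z`, resolvent `G(z) = (zI - A)⁻¹`,
a finite set `F` of indices and positive reals `(a i)_{i ∈ F}`:
`Im(z - ∑_{i ∈ F} aᵢ G(z)ᵢᵢ) / Im(z) ≥ 1`. -/
theorem stmt_2 (n : ℕ) (A : Matrix (Fin n) (Fin n) ℝ) (hA : A.IsSymm)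
    (z : ℂ) (hz : z.im ≠ 0) (F : Finset (Fin n)) (a : Fin n → ℝ)
    (ha : ∀ i ∈ F, 0 < a i) :
    1 ≤ (z - ∑ i ∈ F, (a i : ℂ) *
          ((z • (1 : Matrix (Fin n) (Fin n) ℂ) - A.map Complex.ofReal)⁻¹) i i).im / z.im := by
  choose c hc hG using im_resolvent n A hA z
  have : (z - ∑ i ∈ F, (a i : ℂ) *
      ((z • (1 : Matrix (Fin n) (Fin n) ℂ) - A.map Complex.ofReal)⁻¹) i i).im
      = z.im * (1 + ∑ i ∈ F, a i * c i) := by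
    rw [Complex.sub_im, Complex.im_sum, mul_add, Finset.mul_sum, mul_one, sub_eq_add_neg,
      ← Finset.sum_neg_distrib]
    congr 1
    refine Finset.sum_congr rfl fun i _ => ?_
    rw [Complex.im_ofReal_mul, hG]
    ring
  rw [this, mul_div_cancel_left₀ _ hz]
  have := Finset.sum_nonneg fun i hi => mul_nonneg (ha i hi).le (hc i)
  linarith
end

section
/- Fix τ > 0 and 0 < ε ≤ τ. On the half-plane S = ℝ × (0,∞) consider the measure θ(ds dy) = y^{-2} ds dy, and for t ∈ ℝ define the cone A_ε(t) = {(s,y) ∈ S : y ≥ ε and |s − t| ≤ min(y,τ)/2}. Then for every t ∈ ℝ, θ(A_ε(0) ∩ A_ε(t)) equals ln(τ/ε) + 1 − |t|/ε if |t| ≤ ε; equals ln(τ/|t|) if ε ≤ |t| ≤ τ; and equals 0 if |t| > τ. -/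
open MeasureTheory

/-- The measure `θ(ds dy) = y⁻² ds dy` on the half-plane (as a measure on `ℝ × ℝ`,
with coordinates `(s, y)`). -/
noncomputable def coneMeasure : Measure (ℝ × ℝ) :=
  volume.withDensity fun p => ENNReal.ofReal (1 / p.2 ^ 2)

/-- The truncated cone `A_ε(t) = {(s, y) : y ≥ ε, |s - t| ≤ min(y, τ)/2}`. -/
def cone (τ ε t : ℝ) : Set (ℝ × ℝ) :=
  {p | ε ≤ p.2 ∧ |p.1 - t| ≤ min p.2 τ / 2}

lemma cone_meas (τ ε t : ℝ) : MeasurableSet (cone τ ε t) := by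
  unfold cone
  apply MeasurableSet.inter
  · exact measurableSet_le measurable_const measurable_snd
  · exact measurableSet_le (f := fun p : ℝ × ℝ => |p.1 - t|) (g := fun p => min p.2 τ / 2)
      (by fun_prop) (by fun_prop)

lemma section_vol (m t : ℝ) :
    volume {s : ℝ | |s| ≤ m / 2 ∧ |s - t| ≤ m / 2} = ENNReal.ofReal (m - |t|) := by
  have : {s : ℝ | |s| ≤ m / 2 ∧ |s - t| ≤ m / 2}
      = Set.Icc (max (-(m/2)) (t - m/2)) (min (m/2) (t + m/2)) := by
    ext s
    simp only [Set.mem_ofPred_eq, Set.mem_Icc, abs_le, max_le_iff, le_min_iff]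
    constructor
    · rintro ⟨⟨h1, h2⟩, h3, h4⟩
      refine ⟨⟨?_, ?_⟩, ?_, ?_⟩ <;> linarith
    · rintro ⟨⟨h1, h2⟩, h3, h4⟩
      refine ⟨⟨?_, ?_⟩, ?_, ?_⟩ <;> linarith
  rw [this, Real.volume_Icc]
  congr 1
  rcases le_total 0 t with h | h
  · rw [abs_of_nonneg h, max_eq_right (by linarith), min_eq_left (by linarith)]; ring
  · rw [abs_of_nonpos h, max_eq_left (by linarith), min_eq_right (by linarith)]; ring

lemma cone_formula (τ ε t : ℝ) : coneMeasure (cone τ ε 0 ∩ cone τ ε t)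
    = ∫⁻ y in Set.Ici ε, ENNReal.ofReal (1 / y ^ 2) * ENNReal.ofReal (min y τ - |t|) := by
  have hm := (cone_meas τ ε 0).inter (cone_meas τ ε t)
  unfold coneMeasure
  rw [withDensity_apply _ hm, ← lintegral_indicator hm, Measure.volume_eq_prod,
    lintegral_prod_symm', ← lintegral_indicator measurableSet_Ici]
  · apply lintegral_congr
    intro y
    by_cases hy : ε ≤ y
    · rw [Set.indicator_of_mem (by exact hy), ← section_vol, ← setLIntegral_const,
        ← lintegral_indicator]
      · apply lintegral_congr
        intro s
        simp only [Set.indicator, cone, Set.mem_inter_iff, Set.mem_ofPred_eq, hy, true_and, sub_zero]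
      · exact (measurableSet_le (f := fun s : ℝ => |s|) (g := fun _ => min y τ / 2)
          (by fun_prop) (by fun_prop)).inter
          (measurableSet_le (f := fun s : ℝ => |s - t|) (g := fun _ => min y τ / 2)
          (by fun_prop) (by fun_prop))
    · rw [Set.indicator_of_notMem (by exact hy)]
      simp [Set.indicator, cone, hy]
  · exact Measurable.indicator (by fun_prop) hm

lemma part1 (a τ c : ℝ) (ha : 0 < a) (haτ : a ≤ τ) (hca : c ≤ a) :
    ∫⁻ y in Set.Ioc a τ, ENNReal.ofReal (1 / y ^ 2) * ENNReal.ofReal (min y τ - c)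
      = ENNReal.ofReal (Real.log (τ / a) + c / τ - c / a) := by
  have hc : ContinuousOn (fun y : ℝ => 1 / y - c / y ^ 2) (Set.uIcc a τ) := by
    rw [Set.uIcc_of_le haτ]
    intro y hy
    have : y ≠ 0 := by have := hy.1; intro h; linarith
    apply ContinuousAt.continuousWithinAt
    fun_prop (disch := positivity)
  have hi : IntervalIntegrable (fun y : ℝ => 1 / y - c / y ^ 2) volume a τ := hc.intervalIntegrable
  have key : ∫ y in a..τ, (1 / y - c / y ^ 2) = (Real.log τ + c / τ) - (Real.log a + c / a) := by
    refine intervalIntegral.integral_eq_sub_of_hasDerivAt (f := fun y => Real.log y + c / y) ?_ hi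
    intro y hy
    rw [Set.uIcc_of_le haτ] at hy
    have : y ≠ 0 := by have := hy.1; intro h; linarith
    have h := ((Real.hasDerivAt_log this).add ((hasDerivAt_inv this).const_mul c)).congr_deriv
      (show _ = 1 / y - c / y ^ 2 by ring)
    exact h
  rw [intervalIntegral.integral_of_le haτ] at key
  have e : Real.log (τ / a) + c / τ - c / a = ∫ y in Set.Ioc a τ, (1 / y - c / y ^ 2) := by
    rw [key, Real.log_div (by linarith) ha.ne']; ring
  rw [e, ofReal_integral_eq_lintegral_ofReal]
  · apply setLIntegral_congr_fun measurableSet_Ioc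
    intro y hy
    have h0 : 0 < y := ha.trans hy.1
    simp only
    rw [← ENNReal.ofReal_mul (by positivity), min_eq_left hy.2]
    congr 1
    field_simp
  · exact (intervalIntegrable_iff_integrableOn_Ioc_of_le haτ).1 hi
  · filter_upwards [ae_restrict_mem measurableSet_Ioc] with y hy
    have h0 : 0 < y := ha.trans hy.1
    have : 1 / y - c / y ^ 2 = (y - c) / y ^ 2 := by field_simp
    rw [this]
    exact div_nonneg (by linarith [hy.1]) (by positivity)

lemma part2 (τ c : ℝ) (hτ : 0 < τ) (hc : c ≤ τ) :
    ∫⁻ y in Set.Ioi τ, ENNReal.ofReal (1 / y ^ 2) * ENNReal.ofReal (min y τ - c)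
      = ENNReal.ofReal (1 - c / τ) := by
  have hd : ∀ y ∈ Set.Ici τ, HasDerivAt (fun y : ℝ => -(τ - c) * y⁻¹) ((τ - c) / y ^ 2) y := by
    intro y hy
    have : y ≠ 0 := by have : τ ≤ y := hy; intro h; linarith
    exact ((hasDerivAt_inv this).const_mul (-(τ - c))).congr_deriv (by ring)
  have hp : ∀ y ∈ Set.Ioi τ, 0 ≤ (τ - c) / y ^ 2 := fun y _ =>
    div_nonneg (by linarith) (by positivity)
  have hl : Filter.Tendsto (fun y : ℝ => -(τ - c) * y⁻¹) Filter.atTop (nhds 0) := by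
    simpa using tendsto_inv_atTop_zero.const_mul (-(τ - c))
  have hi := integrableOn_Ioi_deriv_of_nonneg' hd hp hl
  have key := integral_Ioi_of_hasDerivAt_of_nonneg' hd hp hl
  have e : 1 - c / τ = ∫ y in Set.Ioi τ, (τ - c) / y ^ 2 := by
    rw [key]; field_simp; ring
  rw [e, ofReal_integral_eq_lintegral_ofReal hi]
  · apply setLIntegral_congr_fun measurableSet_Ioi
    intro y hy
    have hy' : τ < y := hy
    simp only
    rw [← ENNReal.ofReal_mul (by positivity), min_eq_right hy'.le]
    congr 1
    ring
  · filter_upwards [ae_restrict_mem measurableSet_Ioi] with y hy using hp y hy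

lemma both (a τ c : ℝ) (ha : 0 < a) (haτ : a ≤ τ) (hca : c ≤ a) (h0 : 0 ≤ c) :
    ∫⁻ y in Set.Ioi a, ENNReal.ofReal (1 / y ^ 2) * ENNReal.ofReal (min y τ - c)
      = ENNReal.ofReal (Real.log (τ / a) + 1 - c / a) := by
  have hτ : 0 < τ := ha.trans_le haτ
  rw [← Set.Ioc_union_Ioi_eq_Ioi haτ, lintegral_union measurableSet_Ioi
    (Set.Ioc_disjoint_Ioi le_rfl), part1 a τ c ha haτ hca, part2 τ c hτ (hca.trans haτ),
    ← ENNReal.ofReal_add]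
  · congr 1; ring
  · have h1 := Real.one_sub_inv_le_log_of_pos (div_pos hτ ha)
    rw [inv_div] at h1
    have : c / τ - c / a + (1 - a / τ) = (1 - a / τ) * (1 - c / a) := by field_simp; ring
    have h2 : 0 ≤ (1 - a / τ) * (1 - c / a) := mul_nonneg
      (sub_nonneg.2 ((div_le_one hτ).2 haτ)) (sub_nonneg.2 ((div_le_one ha).2 hca))
    linarith
  · exact sub_nonneg.2 ((div_le_one hτ).2 (hca.trans haτ))

/-- For `0 < ε ≤ τ` and `t ∈ ℝ`, the `θ`-measure of `A_ε(0) ∩ A_ε(t)` equals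
`ln(τ/ε) + 1 - |t|/ε` if `|t| ≤ ε`, equals `ln(τ/|t|)` if `ε ≤ |t| ≤ τ`, and
equals `0` if `|t| > τ`. -/
theorem stmt_8 (τ ε : ℝ) (hτ : 0 < τ) (hε : 0 < ε) (hετ : ε ≤ τ) (t : ℝ) :
    (|t| ≤ ε → coneMeasure (cone τ ε 0 ∩ cone τ ε t)
        = ENNReal.ofReal (Real.log (τ / ε) + 1 - |t| / ε)) ∧
    (ε ≤ |t| → |t| ≤ τ → coneMeasure (cone τ ε 0 ∩ cone τ ε t)
        = ENNReal.ofReal (Real.log (τ / |t|))) ∧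
    (τ < |t| → coneMeasure (cone τ ε 0 ∩ cone τ ε t) = 0) := by
  rw [cone_formula]
  refine ⟨fun h => ?_, fun h1 h2 => ?_, fun h => ?_⟩
  · rw [setLIntegral_congr Ioi_ae_eq_Ici.symm]
    exact both ε τ |t| hε hετ h (abs_nonneg t)
  · have ht : 0 < |t| := hε.trans_le h1
    have e := both |t| τ |t| ht h2 le_rfl ht.le
    rw [div_self ht.ne', add_sub_cancel_right] at e
    rw [← e, setLIntegral_congr Ioi_ae_eq_Ici.symm, ← Set.Ioc_union_Ioi_eq_Ioi h1,
      lintegral_union measurableSet_Ioi (Set.Ioc_disjoint_Ioi le_rfl)]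
    have : ∫⁻ y in Set.Ioc ε |t|, ENNReal.ofReal (1 / y ^ 2) * ENNReal.ofReal (min y τ - |t|)
        = 0 := by
      rw [setLIntegral_congr_fun (g := fun _ => 0) measurableSet_Ioc, lintegral_zero]
      intro y hy
      simp only
      rw [ENNReal.ofReal_of_nonpos (p := min y τ - |t|), mul_zero]
      linarith [min_le_left y τ, hy.2]
    rw [this, zero_add]
  · rw [lintegral_congr (g := fun _ => 0), lintegral_zero]
    intro y
    rw [ENNReal.ofReal_of_nonpos (p := min y τ - |t|), mul_zero]
    linarith [min_le_right y τ]
end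

section
/- Let X be an N×T real matrix and let B be the (T+N)×(T+N) real symmetric block matrix B = [[0, Xᵀ],[X, 0]]. For every z ∈ ℂ \ ℝ, the complex matrices zI_{T+N} − B and z² I_T − XᵀX are invertible, and Σ_{k=1}^{T} ((zI_{T+N} − B)^{-1})_{kk} = z · tr( (z² I_T − XᵀX)^{-1} ), where the sum runs over the first T diagonal entries. -/
open Matrix

/-- The symmetric block matrix `B = [[0, Xᵀ], [X, 0]]`, indexed by `Fin T ⊕ Fin N`. -/
def symBlock {N T : ℕ} {α : Type*} [Zero α] (X : Matrix (Fin N) (Fin T) α) :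
    Matrix (Fin T ⊕ Fin N) (Fin T ⊕ Fin N) α :=
  Matrix.fromBlocks 0 Xᵀ X 0

theorem herm_unit {n : Type*} [Fintype n] [DecidableEq n] (M : Matrix n n ℂ) (hM : M.IsHermitian)
    (z : ℂ) (hz : z.im ≠ 0) : IsUnit (z • (1 : Matrix n n ℂ) - M) := by
  by_contra h
  have h1 : z ∈ spectrum ℂ M := by
    rw [spectrum.mem_iff, Algebra.algebraMap_eq_smul_one]
    exact h
  rw [hM.spectrum_eq_image_range] at h1
  obtain ⟨x, -, hx⟩ := h1
  apply hz
  rw [← hx]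
  simp

/-- For an `N × T` real matrix `X`, the block matrix `B = [[0, Xᵀ], [X, 0]]` and non-real `z`:
`zI - B` and `z²I - XᵀX` are invertible (as complex matrices), and the sum of the first `T`
diagonal entries of `(zI - B)⁻¹` equals `z · tr((z² I - XᵀX)⁻¹)`. -/
theorem stmt_9 (N T : ℕ) (X : Matrix (Fin N) (Fin T) ℝ) (z : ℂ) (hz : z.im ≠ 0) :
    IsUnit (z • (1 : Matrix (Fin T ⊕ Fin N) (Fin T ⊕ Fin N) ℂ) -
        symBlock (X.map Complex.ofReal)) ∧
    IsUnit (z ^ 2 • (1 : Matrix (Fin T) (Fin T) ℂ) -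
        (X.map Complex.ofReal)ᵀ * X.map Complex.ofReal) ∧
    ∑ k : Fin T,
        ((z • (1 : Matrix (Fin T ⊕ Fin N) (Fin T ⊕ Fin N) ℂ) -
            symBlock (X.map Complex.ofReal))⁻¹) (Sum.inl k) (Sum.inl k)
      = z * Matrix.trace ((z ^ 2 • (1 : Matrix (Fin T) (Fin T) ℂ) -
            (X.map Complex.ofReal)ᵀ * X.map Complex.ofReal)⁻¹) := by
  have hH : (symBlock (X.map Complex.ofReal)).IsHermitian := by
    unfold symBlock
    ext i j
    rcases i with i | i <;> rcases j with j | j <;> simp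
  have h1 := herm_unit _ hH z hz
  have h2 : IsUnit (z • (1 : Matrix (Fin T ⊕ Fin N) (Fin T ⊕ Fin N) ℂ) +
      symBlock (X.map Complex.ofReal)) := by
    have := (herm_unit _ hH (-z) (by simpa using hz)).neg
    convert this using 1
    rw [neg_smul]; abel
  generalize X.map Complex.ofReal = Y at *
  have hP : (z • (1 : Matrix (Fin T ⊕ Fin N) (Fin T ⊕ Fin N) ℂ) - symBlock Y) *
      (z • (1 : Matrix (Fin T ⊕ Fin N) (Fin T ⊕ Fin N) ℂ) + symBlock Y) =
      Matrix.fromBlocks (z ^ 2 • (1 : Matrix (Fin T) (Fin T) ℂ) - Yᵀ * Y) 0 0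
        (z ^ 2 • (1 : Matrix (Fin N) (Fin N) ℂ) - Y * Yᵀ) := by
    have hB : symBlock Y * symBlock Y = Matrix.fromBlocks (Yᵀ * Y) 0 0 (Y * Yᵀ) := by
      simp [symBlock, Matrix.fromBlocks_multiply]
    have : (z • (1 : Matrix (Fin T ⊕ Fin N) (Fin T ⊕ Fin N) ℂ) - symBlock Y) *
      (z • (1 : Matrix (Fin T ⊕ Fin N) (Fin T ⊕ Fin N) ℂ) + symBlock Y) =
      z ^ 2 • 1 - symBlock Y * symBlock Y := by
      simp only [sub_mul, mul_add, smul_mul_assoc, mul_smul_comm, one_mul, mul_one, smul_sub, smul_add, smul_smul, sq]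
      abel
    rw [this, hB, ← Matrix.fromBlocks_one, Matrix.fromBlocks_smul, sub_eq_add_neg,
      Matrix.fromBlocks_neg, Matrix.fromBlocks_add]
    simp [sub_eq_add_neg]
  have hU := h1.mul h2
  rw [hP] at hU
  obtain ⟨hG, hG'⟩ := Matrix.isUnit_fromBlocks_zero₂₁.1 hU
  refine ⟨h1, hG, ?_⟩
  have hinv : (z • (1 : Matrix (Fin T ⊕ Fin N) (Fin T ⊕ Fin N) ℂ) - symBlock Y)⁻¹ =
      (z • (1 : Matrix (Fin T ⊕ Fin N) (Fin T ⊕ Fin N) ℂ) + symBlock Y) *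
      Matrix.fromBlocks (z ^ 2 • (1 : Matrix (Fin T) (Fin T) ℂ) - Yᵀ * Y)⁻¹ 0 0
        (z ^ 2 • (1 : Matrix (Fin N) (Fin N) ℂ) - Y * Yᵀ)⁻¹ := by
    apply Matrix.inv_eq_right_inv
    rw [← mul_assoc, hP, Matrix.fromBlocks_multiply,
      Matrix.mul_nonsing_inv _ ((Matrix.isUnit_iff_isUnit_det _).1 hG),
      Matrix.mul_nonsing_inv _ ((Matrix.isUnit_iff_isUnit_det _).1 hG')]
    simp
  rw [hinv, Matrix.trace, Finset.mul_sum]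
  refine Finset.sum_congr rfl fun k _ => ?_
  rw [add_mul, smul_mul_assoc, one_mul, symBlock, Matrix.fromBlocks_multiply]
  simp
end

section
/- Let A be an n×n real symmetric matrix with n ≥ 2, k an index, and z ∈ ℂ \ ℝ. Let A^{(k)} be the (n−1)×(n−1) matrix obtained from A by deleting the k-th row and column. Then z − A_{kk} − Σ_{s,t ≠ k} A_{ks} A_{kt} ((zI − A^{(k)})^{-1})_{st} ≠ 0 and ((zI − A)^{-1})_{kk} = ( z − A_{kk} − Σ_{s,t ≠ k} A_{ks} A_{kt} ((zI − A^{(k)})^{-1})_{st} )^{-1}. -/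
theorem aux_unit {n : ℕ} (B : Matrix (Fin n) (Fin n) ℝ) (hB : B.IsSymm) (z : ℂ) (hz : z.im ≠ 0) :
    IsUnit (z • (1 : Matrix (Fin n) (Fin n) ℂ) - B.map Complex.ofReal) := by
  have hH : (B.map Complex.ofReal).IsHermitian := by
    ext i j
    simp [Matrix.conjTranspose_apply, hB.apply i j]
  by_contra h
  have h2 : z ∈ spectrum ℂ (B.map Complex.ofReal) := by
    rw [spectrum.mem_iff, Algebra.algebraMap_eq_smul_one]
    exact h
  rw [hH.spectrum_eq_image_range] at h2
  obtain ⟨x, -, rfl⟩ := h2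
  exact hz (by simp)

/-- Schur complement formula for the diagonal resolvent entry. Let `A` be an `n × n`
(`n = m + 2 ≥ 2`) real symmetric matrix, `k` an index, `z` non-real, and `A⁽ᵏ⁾` the principal
submatrix of `A` deleting the `k`-th row and column (indices `t ≠ k` being parametrized as
`t = k.succAbove s`). Then `z - Aₖₖ - ∑_{s,t ≠ k} A_{ks} A_{kt} ((zI - A⁽ᵏ⁾)⁻¹)_{st} ≠ 0` and
`((zI - A)⁻¹)ₖₖ` equals its inverse. -/
theorem stmt_13 (m : ℕ) (A : Matrix (Fin (m + 2)) (Fin (m + 2)) ℝ) (hA : A.IsSymm)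
    (z : ℂ) (hz : z.im ≠ 0) (k : Fin (m + 2)) :
    (z - (A k k : ℂ) - ∑ s : Fin (m + 1), ∑ t : Fin (m + 1),
        (A k (k.succAbove s) : ℂ) * (A k (k.succAbove t) : ℂ) *
          ((z • (1 : Matrix (Fin (m + 1)) (Fin (m + 1)) ℂ) -
              (A.submatrix k.succAbove k.succAbove).map Complex.ofReal)⁻¹) s t) ≠ 0 ∧
    ((z • (1 : Matrix (Fin (m + 2)) (Fin (m + 2)) ℂ) - A.map Complex.ofReal)⁻¹) k k
      = (z - (A k k : ℂ) - ∑ s : Fin (m + 1), ∑ t : Fin (m + 1),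
          (A k (k.succAbove s) : ℂ) * (A k (k.succAbove t) : ℂ) *
            ((z • (1 : Matrix (Fin (m + 1)) (Fin (m + 1)) ℂ) -
                (A.submatrix k.succAbove k.succAbove).map Complex.ofReal)⁻¹) s t)⁻¹ := by
  have hM := aux_unit A hA z hz
  have hD := aux_unit (A.submatrix k.succAbove k.succAbove) (hA.submatrix _) z hz
  set M := z • (1 : Matrix (Fin (m + 2)) (Fin (m + 2)) ℂ) - A.map Complex.ofReal with hMdef
  set D := z • (1 : Matrix (Fin (m + 1)) (Fin (m + 1)) ℂ) -
              (A.submatrix k.succAbove k.succAbove).map Complex.ofReal with hDdef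
  have hMG : M * M⁻¹ = 1 := Matrix.mul_nonsing_inv _ ((Matrix.isUnit_iff_isUnit_det _).1 hM)
  have hHD : D⁻¹ * D = 1 := Matrix.nonsing_inv_mul _ ((Matrix.isUnit_iff_isUnit_det _).1 hD)
  set G := M⁻¹
  set H := D⁻¹
  have hkk : M k k = z - (A k k : ℂ) := by simp [hMdef]
  have hks : ∀ s, M k (k.succAbove s) = - (A k (k.succAbove s) : ℂ) := by
    intro s
    simp [hMdef, Matrix.one_apply, (Fin.succAbove_ne k s).symm]
  have hsk : ∀ s, M (k.succAbove s) k = - (A k (k.succAbove s) : ℂ) := by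
    intro s
    simp [hMdef, Matrix.one_apply, Fin.succAbove_ne k s, hA.apply k (k.succAbove s)]
  have hst : ∀ s t, M (k.succAbove s) (k.succAbove t) = D s t := by
    intro s t
    simp [hMdef, hDdef, Matrix.one_apply]
  have e1 : (z - (A k k : ℂ)) * G k k
      - ∑ s, (A k (k.succAbove s) : ℂ) * G (k.succAbove s) k = 1 := by
    have := congrFun (congrFun hMG k) k
    rw [Matrix.mul_apply, Fin.sum_univ_succAbove _ k, hkk] at this
    simpa [hks, sub_eq_add_neg] using this
  have e2 : D.mulVec (fun t => G (k.succAbove t) k)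
      = fun s => (A k (k.succAbove s) : ℂ) * G k k := by
    funext s
    have := congrFun (congrFun hMG (k.succAbove s)) k
    rw [Matrix.mul_apply, Fin.sum_univ_succAbove _ k, hsk,
      Matrix.one_apply_ne (Fin.succAbove_ne k s)] at this
    simp only [hst] at this
    simp only [Matrix.mulVec, dotProduct]
    linear_combination this
  have e3 : ∀ s, G (k.succAbove s) k = ∑ t, H s t * ((A k (k.succAbove t) : ℂ) * G k k) := by
    intro s
    have := congrFun (congrArg H.mulVec e2) s
    rw [Matrix.mulVec_mulVec, hHD, Matrix.one_mulVec] at this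
    simpa [Matrix.mulVec, dotProduct] using this
  have key : G k k * (z - (A k k : ℂ) - ∑ s : Fin (m + 1), ∑ t : Fin (m + 1),
        (A k (k.succAbove s) : ℂ) * (A k (k.succAbove t) : ℂ) * H s t) = 1 := by
    rw [← e1, mul_sub, Finset.mul_sum, mul_comm]
    congr 1
    refine Finset.sum_congr rfl fun s _ => ?_
    rw [e3, Finset.mul_sum, Finset.mul_sum]
    refine Finset.sum_congr rfl fun t _ => ?_
    ring
  exact ⟨right_ne_zero_of_mul_eq_one key, eq_inv_of_mul_eq_one_left key⟩
end

section
/- Let A be an n×n complex matrix, m an index, and let Â be the matrix obtained from A by setting every entry of the m-th row and of the m-th column equal to 0. Let z ∈ ℂ be such that both zI − A and zI − Â are invertible, and set G = (zI − A)^{-1} and Ĝ = (zI − Â)^{-1}. Then for every index t ≠ m: G_{tt} − Ĝ_{tt} = G_{tm} · Σ_{j ≠ m} A_{mj} Ĝ_{jt}. -/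
/-- The matrix obtained from `A` by setting every entry of the `m`-th row and of the
`m`-th column equal to `0`. -/
def zeroRowColC {n : ℕ} (A : Matrix (Fin n) (Fin n) ℂ) (m : Fin n) :
    Matrix (Fin n) (Fin n) ℂ :=
  Matrix.of fun i j => if i = m ∨ j = m then 0 else A i j

/-- Let `A` be an `n × n` complex matrix, `Â` the matrix `A` with its `m`-th row and column
zeroed out, and `z ∈ ℂ` such that both `zI - A` and `zI - Â` are invertible, with resolvents
`G = (zI - A)⁻¹` and `Ĝ = (zI - Â)⁻¹`. Then for every `t ≠ m`:
`Gₜₜ - Ĝₜₜ = G_{tm} · ∑_{j ≠ m} A_{mj} Ĝ_{jt}`. -/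
theorem stmt_18 (n : ℕ) (A : Matrix (Fin n) (Fin n) ℂ) (m : Fin n) (z : ℂ)
    (h1 : IsUnit (z • (1 : Matrix (Fin n) (Fin n) ℂ) - A))
    (h2 : IsUnit (z • (1 : Matrix (Fin n) (Fin n) ℂ) - zeroRowColC A m))
    (t : Fin n) (ht : t ≠ m) :
    ((z • (1 : Matrix (Fin n) (Fin n) ℂ) - A)⁻¹) t t -
        ((z • (1 : Matrix (Fin n) (Fin n) ℂ) - zeroRowColC A m)⁻¹) t t
      = ((z • (1 : Matrix (Fin n) (Fin n) ℂ) - A)⁻¹) t m *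
          ∑ j ∈ Finset.univ.erase m,
            A m j * ((z • (1 : Matrix (Fin n) (Fin n) ℂ) - zeroRowColC A m)⁻¹) j t := by
  have d1 := (Matrix.isUnit_iff_isUnit_det _).1 h1
  have d2 := (Matrix.isUnit_iff_isUnit_det _).1 h2
  have e1 := Matrix.nonsing_inv_mul _ d1
  have e2 := Matrix.mul_nonsing_inv _ d2
  generalize hG : (z • (1 : Matrix (Fin n) (Fin n) ℂ) - A)⁻¹ = G at *
  generalize hH : (z • (1 : Matrix (Fin n) (Fin n) ℂ) - zeroRowColC A m)⁻¹ = H at *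
  have row : ∀ s, z * H m s = (1 : Matrix (Fin n) (Fin n) ℂ) m s := by
    intro s
    have h0 : (zeroRowColC A m * H) m s = 0 := by
      rw [Matrix.mul_apply]
      apply Finset.sum_eq_zero
      intro j _
      simp [zeroRowColC]
    rw [← e2, Matrix.sub_mul, Matrix.sub_apply, h0]
    simp
  have hz : z ≠ 0 := by
    rintro rfl
    have := row m
    simp at this
  have hm : H m t = 0 := by
    have := row t
    rw [Matrix.one_apply_ne ht.symm] at this
    exact (mul_eq_zero.1 this).resolve_left hz
  have key : G - H = G * ((A - zeroRowColC A m) * H) := by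
    have : A - zeroRowColC A m =
        (z • (1 : Matrix (Fin n) (Fin n) ℂ) - zeroRowColC A m) - (z • 1 - A) := by abel
    rw [this, Matrix.sub_mul, e2, Matrix.mul_sub, ← Matrix.mul_assoc, e1]
    simp
  rw [← Matrix.sub_apply, key, Matrix.mul_apply, Finset.sum_eq_single m]
  · congr 1
    rw [Matrix.mul_apply, ← Finset.add_sum_erase _ _ (Finset.mem_univ m), hm, mul_zero, zero_add]
    apply Finset.sum_congr rfl
    intro j _
    simp [zeroRowColC]
  · intro i _ hi
    rw [Matrix.mul_apply, Finset.sum_eq_zero, mul_zero]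
    intro j _
    by_cases hj : j = m
    · rw [hj, hm, mul_zero]
    · simp [zeroRowColC, hi, hj]
  · simp
end
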